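/- For every integer n ≥ 3, no point in the open interior of the regular n-gon other than the center 0 lies on 8 or more diagonals. -/

import Mathlib

noncomputable section

/-- The regular `n`-gon: the convex hull of the `n`-th roots of unity in `ℂ`. -/
def Ngon (n : ℕ) : Set ℂ := convexHull ℝ {z : ℂ | z ^ n = 1}

/-- `s` is a diagonal of the regular `n`-gon: the closed segment joining two
distinct non-adjacent vertices. -/
def IsDiagonal (n : ℕ) (s : Set ℂ) : Prop :=
  ∃ v w : ℂ, v ^ n = 1 ∧ w ^ n = 1 ∧ v ≠ w ∧
    w ≠ v * Complex.exp (2 * Real.pi * Complex.I / n) ∧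
    v ≠ w * Complex.exp (2 * Real.pi * Complex.I / n) ∧
    s = segment ℝ v w

/-- A subfield of `ℂ` containing the `M`-th roots of unity, together with a ring embedding of it
that raises these roots to the `k`-th power. -/
structure RootPowerMap (M k : ℕ) where
  /-- The subfield on which the map is a ring homomorphism. -/
  K : Subfield ℂ
  /-- The map, extended by zero. -/
  φ : ℂ → ℂ
  map_add : ∀ a ∈ K, ∀ b ∈ K, φ (a + b) = φ a + φ b
  map_mul : ∀ a ∈ K, ∀ b ∈ K, φ (a * b) = φ a * φ b
  mem : ∀ z, z ^ M = 1 → z ∈ K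
  map_root : ∀ z, z ^ M = 1 → φ z = z ^ k
  torsion : Odd M → ∀ z ∈ K, IsOfFinOrder z → z ^ M = 1 ∨ (-z) ^ M = 1

namespace RootPowerMap

open IntermediateField in
theorem nonempty {M k : ℕ} (hM : 0 < M) (hk : k.Coprime M) : Nonempty (RootPowerMap M k) := by
  classical
  have : NeZero M := ⟨hM.ne'⟩
  obtain ⟨ζ, hζ⟩ : ∃ ζ : ℂ, IsPrimitiveRoot ζ M := ⟨_, Complex.isPrimitiveRoot_exp M hM.ne'⟩
  have h_int : IsIntegral ℚ ζ := (hζ.isIntegral hM).tower_top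
  have hroot : ζ ^ k ∈ (minpoly ℚ ζ).aroots ℂ := by
    rw [Polynomial.mem_aroots]
    refine ⟨minpoly.ne_zero h_int, ?_⟩
    rw [← Polynomial.cyclotomic_eq_minpoly_rat hζ hM,
      Polynomial.cyclotomic_eq_minpoly_rat (hζ.pow_of_coprime k hk) hM, minpoly.aeval]
  let f : ℚ⟮ζ⟯ →ₐ[ℚ] ℂ := (algHomAdjoinIntegralEquiv ℚ h_int).symm ⟨ζ ^ k, hroot⟩
  have hf : f (AdjoinSimple.gen ℚ ζ) = ζ ^ k :=
    algHomAdjoinIntegralEquiv_symm_apply_gen ℚ h_int _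
  have hmem : ∀ z : ℂ, z ^ M = 1 → ∃ i : ℕ, ζ ^ i = z := fun z hz =>
    let ⟨i, _, hi⟩ := hζ.eq_pow_of_pow_eq_one hz
    ⟨i, hi⟩
  refine ⟨⟨ℚ⟮ζ⟯.toSubfield, fun z => if h : z ∈ ℚ⟮ζ⟯ then f ⟨z, h⟩ else 0, ?_, ?_, ?_, ?_, ?_⟩⟩
  · intro a (ha : a ∈ ℚ⟮ζ⟯) b (hb : b ∈ ℚ⟮ζ⟯)
    rw [dif_pos ha, dif_pos hb, dif_pos (add_mem ha hb), ← _root_.map_add]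
    rfl
  · intro a (ha : a ∈ ℚ⟮ζ⟯) b (hb : b ∈ ℚ⟮ζ⟯)
    rw [dif_pos ha, dif_pos hb, dif_pos (mul_mem ha hb), ← _root_.map_mul]
    rfl
  · intro z hz
    obtain ⟨i, rfl⟩ := hmem z hz
    exact pow_mem (mem_adjoin_simple_self ℚ ζ) i
  · intro z hz
    obtain ⟨i, rfl⟩ := hmem z hz
    have hz' : ζ ^ i ∈ ℚ⟮ζ⟯ := pow_mem (mem_adjoin_simple_self ℚ ζ) i
    have : (⟨ζ ^ i, hz'⟩ : ℚ⟮ζ⟯) = AdjoinSimple.gen ℚ ζ ^ i := Subtype.ext (by simp)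
    rw [dif_pos hz', this, map_pow, hf, ← pow_mul, ← pow_mul, mul_comm]
  · intro hodd z hz hfin
    have : IsCyclotomicExtension {M} ℚ ℚ⟮ζ⟯ := by
      change IsCyclotomicExtension {M} ℚ (ℚ⟮ζ⟯).toSubalgebra
      rw [IntermediateField.adjoin_simple_toSubalgebra_of_isAlgebraic h_int.isAlgebraic]
      exact hζ.adjoin_isCyclotomicExtension ℚ
    have := IsCyclotomicExtension.numberField {M} ℚ ℚ⟮ζ⟯
    have hgen : IsPrimitiveRoot (AdjoinSimple.gen ℚ ζ) M :=
      IsPrimitiveRoot.of_map_of_injective (f := algebraMap ℚ⟮ζ⟯ ℂ) (by simpa using hζ)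
        (algebraMap ℚ⟮ζ⟯ ℂ).injective
    have hfin' : IsOfFinOrder (⟨z, hz⟩ : ℚ⟮ζ⟯) := by
      rw [isOfFinOrder_iff_pow_eq_one] at hfin ⊢
      obtain ⟨n, hn, h⟩ := hfin
      exact ⟨n, hn, Subtype.ext (by simpa using h)⟩
    obtain ⟨r, hr⟩ := hgen.exists_neg_pow_of_isOfFinOrder hodd hfin'
    have hr : z = (-ζ) ^ r := by simpa using congrArg Subtype.val hr
    have h1 : (ζ ^ r) ^ M = 1 := by rw [← pow_mul, mul_comm, pow_mul, hζ.pow_eq_one, one_pow]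
    rw [hr, neg_pow ζ r]
    rcases neg_one_pow_eq_or ℂ r with h | h <;> simp [h, h1]

theorem map_zero {M k : ℕ} (E : RootPowerMap M k) : E.φ 0 = 0 := by
  have := E.map_add 0 E.K.zero_mem 0 E.K.zero_mem
  simpa using this

theorem map_neg {M k : ℕ} (E : RootPowerMap M k) {a : ℂ} (ha : a ∈ E.K) : E.φ (-a) = -E.φ a := by
  have := E.map_add a ha (-a) (E.K.neg_mem ha)
  rw [add_neg_cancel, E.map_zero] at this
  linear_combination -this

theorem map_line {M k : ℕ} (E : RootPowerMap M k) {p r x y : ℂ} (hp : p ∈ E.K) (hr : r ∈ E.K)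
    (hx : x ∈ E.K) (hy : y ∈ E.K) (h : x + y = p + x * y * r) :
    E.φ x + E.φ y = E.φ p + E.φ x * E.φ y * E.φ r := by
  have hxy := E.K.mul_mem hx hy
  rw [← E.map_mul x hx y hy, ← E.map_mul _ hxy r hr, ← E.map_add x hx y hy,
    ← E.map_add p hp _ (E.K.mul_mem hxy hr), h]

theorem sum_map_root {M k : ℕ} (E : RootPowerMap M k) {ι : Type*} (S : Finset ι)
    (f : ι → ℂ) (hf : ∀ i ∈ S, f i ^ M = 1) (h : ∑ i ∈ S, f i = 0) : ∑ i ∈ S, f i ^ k = 0 := by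
  classical
  have : ∀ T ⊆ S, E.φ (∑ i ∈ T, f i) = ∑ i ∈ T, f i ^ k := by
    intro T
    induction T using Finset.induction_on with
    | empty => simp [E.map_zero]
    | insert a T ha ih =>
      intro hT
      have haS := hT (Finset.mem_insert_self a T)
      have hTS := (Finset.subset_insert a T).trans hT
      rw [Finset.sum_insert ha, Finset.sum_insert ha,
        E.map_add _ (E.mem _ (hf a haS)) _ (E.K.sum_mem fun i hi => E.mem _ (hf i (hTS hi))),
        E.map_root _ (hf a haS), ih hTS]
  rw [← this S subset_rfl, h, E.map_zero]

end RootPowerMap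

open ComplexConjugate in
/-- `s` is the product of the endpoints, both `M`-th roots of unity, of a chord of the unit circle
which passes through `p` but not through `0`. -/
def IsChordProduct (p : ℂ) (M : ℕ) (s : ℂ) : Prop :=
  ∃ x y : ℂ, x ^ M = 1 ∧ y ^ M = 1 ∧ x * y = s ∧ x + y ≠ 0 ∧ x + y = p + s * conj p

theorem card_le_two_of_quadratic {S : Finset ℂ} {a b c : ℂ} (h0 : a ≠ 0 ∨ b ≠ 0 ∨ c ≠ 0)
    (h : ∀ s ∈ S, a * s ^ 2 + b * s + c = 0) : S.card ≤ 2 := by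
  open Polynomial in
  have hne : (C a * X ^ 2 + C b * X + C c : ℂ[X]) ≠ 0 := by
    intro h
    have h0' := congrArg (coeff · 0) h
    have h1' := congrArg (coeff · 1) h
    have h2' := congrArg (coeff · 2) h
    simp [coeff_X, coeff_C] at h0' h1' h2'
    simp [h0', h1', h2'] at h0
  refine (Polynomial.card_le_degree_of_subset_roots (p := (C a * X ^ 2 + C b * X + C c : ℂ[X]))
    fun s hs => ?_).trans Polynomial.natDegree_quadratic_le
  simpa [hne] using h s hs

theorem card_le_four_of_quartic {S : Finset ℂ} {a b c d e : ℂ} (hd : d ≠ 0)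
    (h : ∀ s ∈ S, a * s ^ 4 + b * s ^ 3 + c * s ^ 2 + d * s + e = 0) : S.card ≤ 4 := by
  open Polynomial in
  have hne : (C a * X ^ 4 + C b * X ^ 3 + C c * X ^ 2 + C d * X + C e : ℂ[X]) ≠ 0 := by
    intro h
    have h1' := congrArg (coeff · 1) h
    simp [coeff_C] at h1'
    exact hd h1'
  refine (Polynomial.card_le_degree_of_subset_roots
    (p := (C a * X ^ 4 + C b * X ^ 3 + C c * X ^ 2 + C d * X + C e : ℂ[X]))
    fun s hs => ?_).trans (by compute_degree)
  simpa [hne] using h s hs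

theorem norm_eq_one_of_pow {z : ℂ} {M : ℕ} (hM : M ≠ 0) (h : z ^ M = 1) : ‖z‖ = 1 :=
  Complex.norm_eq_one_of_pow_eq_one h hM

theorem IsChordProduct.mem_field {p s t : ℂ} {M n k : ℕ} (E : RootPowerMap n k)
    (hmem : ∀ z : ℂ, z ^ M = 1 → z ∈ E.K)
    (hs : IsChordProduct p M s) (ht : IsChordProduct p M t) (hst : s ≠ t) :
    p ∈ E.K ∧ (starRingEnd ℂ) p ∈ E.K := by
  obtain ⟨x, y, hx, hy, hxy, -, h⟩ := hs
  obtain ⟨x', y', hx', hy', hxy', -, h'⟩ := ht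
  have hsK : s ∈ E.K := hxy ▸ E.K.mul_mem (hmem x hx) (hmem y hy)
  have htK : t ∈ E.K := hxy' ▸ E.K.mul_mem (hmem x' hx') (hmem y' hy')
  have h1 := E.K.add_mem (hmem x hx) (hmem y hy)
  have h2 := E.K.add_mem (hmem x' hx') (hmem y' hy')
  have hr : (starRingEnd ℂ) p = (x + y - (x' + y')) / (s - t) := by
    rw [eq_div_iff (sub_ne_zero.2 hst), h, h']; ring
  have hrK : (starRingEnd ℂ) p ∈ E.K := by
    rw [hr]; exact E.K.div_mem (E.K.sub_mem h1 h2) (E.K.sub_mem hsK htK)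
  refine ⟨?_, hrK⟩
  have : p = x + y - s * (starRingEnd ℂ) p := by rw [h]; ring
  rw [this]
  exact E.K.sub_mem h1 (E.K.mul_mem hsK hrK)

open ComplexConjugate in
theorem exists_rotation_of_four_dvd {p : ℂ} {k : ℕ} (hk : 0 < k) (hp : ‖p‖ < 1)
    {S : Finset ℂ} (hcard : 5 ≤ S.card) (hS : ∀ s ∈ S, IsChordProduct p (4 * k) s) :
    ∃ ρ : ℂ, ρ ^ (4 * k) = 1 ∧ ∀ s ∈ S, IsChordProduct (ρ * p) (2 * k) (ρ ^ 2 * s) := by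
  classical
  have hcop : (1 + 2 * k).Coprime (4 * k) := by
    have h2 : (1 + 2 * k).Coprime (2 * k) := by simp
    have h4 : 4 * k = 2 * (2 * k) := by ring
    rw [h4]
    exact Nat.Coprime.mul_right (by simp) h2
  obtain ⟨E⟩ := RootPowerMap.nonempty (M := 4 * k) (by omega) hcop
  obtain ⟨s₁, hs₁, s₂, hs₂, hne⟩ := Finset.one_lt_card.1 (show 1 < S.card by omega)
  obtain ⟨hpK, hrK⟩ := (hS s₁ hs₁).mem_field E E.mem (hS s₂ hs₂) hne
  have hrn : ‖conj p‖ < 1 := by simpa using hp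
  have hsq : ∀ x : ℂ, x ^ (4 * k) = 1 → x ^ (2 * k) = 1 ∧ E.φ x = x ∨
      x ^ (2 * k) = -1 ∧ E.φ x = -x := by
    intro x hx
    have : (x ^ (2 * k)) ^ 2 = 1 := by rw [← pow_mul, ← hx]; ring_nf
    rw [E.map_root x hx, pow_add, pow_one]
    rcases sq_eq_sq_iff_eq_or_eq_neg.1 (this.trans (one_pow 2).symm) with h | h <;> simp [h]
  have himage : ∀ s ∈ S, ∃ x y : ℂ, x ^ (4 * k) = 1 ∧ y ^ (4 * k) = 1 ∧ x * y = s ∧ x + y ≠ 0 ∧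
      x + y = p + s * conj p ∧
      (x ^ (2 * k) = 1 ∧ y ^ (2 * k) = 1 ∧ x + y = E.φ p + s * E.φ (conj p) ∨
        x ^ (2 * k) = -1 ∧ y ^ (2 * k) = -1 ∧ -(x + y) = E.φ p + s * E.φ (conj p) ∨
        x - y = E.φ p - s * E.φ (conj p)) := by
    intro s hs
    obtain ⟨x, y, hx, hy, hxy, h0, h⟩ := hS s hs
    have hφ := E.map_line hpK hrK (E.mem x hx) (E.mem y hy) (by rw [hxy]; exact h)
    rcases hsq x hx with ⟨hx2, hφx⟩ | ⟨hx2, hφx⟩ <;>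
      rcases hsq y hy with ⟨hy2, hφy⟩ | ⟨hy2, hφy⟩ <;> rw [hφx, hφy] at hφ
    · exact ⟨x, y, hx, hy, hxy, h0, h, .inl ⟨hx2, hy2, by rw [← hxy]; exact hφ⟩⟩
    · exact ⟨x, y, hx, hy, hxy, h0, h, .inr (.inr (by rw [← hxy]; linear_combination hφ))⟩
    · exact ⟨y, x, hy, hx, by rw [mul_comm, hxy], by rwa [add_comm], by rwa [add_comm],
        .inr (.inr (by rw [← hxy]; linear_combination hφ))⟩
    · exact ⟨x, y, hx, hy, hxy, h0, h,
        .inr (.inl ⟨hx2, hy2, by rw [← hxy]; linear_combination hφ⟩)⟩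
  by_cases hfix : E.φ p = p ∧ E.φ (conj p) = conj p
  · refine ⟨1, one_pow _, fun s hs => ?_⟩
    obtain ⟨x, y, hx, hy, hxy, h0, h, h1 | h1 | h1⟩ := himage s hs
    · exact ⟨x, y, h1.1, h1.2.1, by simpa using hxy, h0, by simpa using h⟩
    · rw [hfix.1, hfix.2, ← h] at h1
      exact absurd (by linear_combination (-1 / 2) * h1.2.2) h0
    · rw [hfix.1, hfix.2] at h1
      have : p = x := by linear_combination (-1 / 2) * h - (1 / 2) * h1
      rw [this, norm_eq_one_of_pow (by omega) hx] at hp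
      exact absurd hp (lt_irrefl _)
  by_cases hneg : E.φ p = -p ∧ E.φ (conj p) = -conj p
  · obtain ⟨ρ, hρ⟩ : ∃ ρ : ℂ, IsPrimitiveRoot ρ (4 * k) :=
      ⟨_, Complex.isPrimitiveRoot_exp _ (by omega)⟩
    have hρ2 : ρ ^ (2 * k) = -1 := by
      rcases hsq ρ hρ.pow_eq_one with h | h
      · exact absurd (Nat.le_of_dvd (by omega) (hρ.dvd_of_pow_eq_one _ h.1)) (by omega)
      · exact h.1
    have hρρ : ρ * conj ρ = 1 := by
      rw [Complex.mul_conj, Complex.normSq_eq_norm_sq,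
        norm_eq_one_of_pow (by omega) hρ.pow_eq_one]; simp
    refine ⟨ρ, hρ.pow_eq_one, fun s hs => ?_⟩
    have hρ0 : ρ ≠ 0 := left_ne_zero_of_mul_eq_one hρρ
    obtain ⟨x, y, hx, hy, hxy, h0, h, h1 | h1 | h1⟩ := himage s hs
    · rw [hneg.1, hneg.2] at h1
      exact absurd (by linear_combination (1 / 2) * h + (1 / 2) * h1.2.2) h0
    · refine ⟨ρ * x, ρ * y, by rw [mul_pow, hρ2, h1.1]; ring, by rw [mul_pow, hρ2, h1.2.1]; ring,
        by rw [← hxy]; ring, by rw [← mul_add]; exact mul_ne_zero hρ0 h0, ?_⟩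
      rw [map_mul]
      linear_combination ρ * h - ρ * s * conj p * hρρ
    · rw [hneg.1, hneg.2] at h1
      have hx0 : x ≠ 0 := by rintro rfl; simp [hk.ne'] at hx
      have : y * conj p = 1 := by
        refine mul_left_cancel₀ hx0 ?_
        linear_combination (-1 / 2) * h - (1 / 2) * h1 + conj p * hxy
      have := congrArg norm this
      rw [norm_mul, norm_eq_one_of_pow (by omega) hy, one_mul, norm_one] at this
      exact absurd hrn (by rw [this]; exact lt_irrefl _)
  exfalso
  let S₁ := S.filter fun s => (p - E.φ p) + s * (conj p - E.φ (conj p)) = 0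
  let S₂ := S.filter fun s => (p + E.φ p) + s * (conj p + E.φ (conj p)) = 0
  let S₃ := S.filter fun s => (conj p ^ 2 - E.φ (conj p) ^ 2) * s ^ 2 +
    (2 * (p * conj p + E.φ p * E.φ (conj p)) - 4) * s + (p ^ 2 - E.φ p ^ 2) = 0
  have h₁ : S₁.card ≤ 1 := by
    refine Finset.card_le_one.2 fun a ha b hb => ?_
    have ha := (Finset.mem_filter.1 ha).2
    have hb := (Finset.mem_filter.1 hb).2
    have : (a - b) * (conj p - E.φ (conj p)) = 0 := by linear_combination ha - hb
    rcases mul_eq_zero.1 this with h | h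
    · exact sub_eq_zero.1 h
    · rw [h, mul_zero, add_zero] at ha
      exact absurd ⟨(sub_eq_zero.1 ha).symm, (sub_eq_zero.1 h).symm⟩ hfix
  have h₂ : S₂.card ≤ 1 := by
    refine Finset.card_le_one.2 fun a ha b hb => ?_
    have ha := (Finset.mem_filter.1 ha).2
    have hb := (Finset.mem_filter.1 hb).2
    have : (a - b) * (conj p + E.φ (conj p)) = 0 := by linear_combination ha - hb
    rcases mul_eq_zero.1 this with h | h
    · exact sub_eq_zero.1 h
    · rw [h, mul_zero, add_zero] at ha
      exact absurd ⟨by linear_combination ha, by linear_combination h⟩ hneg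
  have h₃ : S₃.card ≤ 2 := by
    refine card_le_two_of_quadratic ?_ fun s hs => (Finset.mem_filter.1 hs).2
    by_contra! hcon
    obtain ⟨ha, hb, hc⟩ := hcon
    rcases mul_eq_zero.1 (show (p - E.φ p) * (p + E.φ p) = 0 by linear_combination hc) with h | h <;>
      rcases mul_eq_zero.1 (show (conj p - E.φ (conj p)) * (conj p + E.φ (conj p)) = 0 by
        linear_combination ha) with h' | h'
    · exact hfix ⟨(sub_eq_zero.1 h).symm, (sub_eq_zero.1 h').symm⟩
    · have h2 : (4 : ℂ) = 0 := by
        linear_combination -hb - 2 * E.φ (conj p) * h + 2 * p * h'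
      norm_num at h2
    · have h2 : (4 : ℂ) = 0 := by
        linear_combination -hb + 2 * E.φ (conj p) * h + 2 * p * h'
      norm_num at h2
    · exact hneg ⟨by linear_combination h, by linear_combination h'⟩
  have hsub : S ⊆ S₁ ∪ S₂ ∪ S₃ := by
    intro s hs
    obtain ⟨x, y, hx, hy, hxy, h0, h, h1 | h1 | h1⟩ := himage s hs <;>
      simp only [S₁, S₂, S₃, Finset.mem_union, Finset.mem_filter, hs, true_and]
    · exact .inl (.inl (by linear_combination -h + h1.2.2))
    · exact .inl (.inr (by linear_combination -h - h1.2.2))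
    · refine .inr ?_
      linear_combination 4 * hxy - (p + s * conj p + x + y) * h +
        (E.φ p - s * E.φ (conj p) + x - y) * h1
  have := Finset.card_le_card hsub
  have := Finset.card_union_le (S₁ ∪ S₂) S₃
  have := Finset.card_union_le S₁ S₂
  omega

/-- A monic quartic with a double root does not have four distinct roots. -/
theorem false_of_double_root {x₁ x₂ x₃ x₄ h k : ℂ}
    (h12 : x₁ ≠ x₂) (h13 : x₁ ≠ x₃) (h14 : x₁ ≠ x₄) (h23 : x₂ ≠ x₃) (h24 : x₂ ≠ x₄) (h34 : x₃ ≠ x₄)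
    (H : ∀ X, (X - x₁) * (X - x₂) * (X - x₃) * (X - x₄) = (X - h) ^ 2 * (X ^ 2 - k * X + h ^ 2)) :
    False := by
  have hroot : (h - x₁) * (h - x₂) * (h - x₃) * (h - x₄) = 0 := by rw [H]; ring
  have hderiv : (h - x₂) * (h - x₃) * (h - x₄) + (h - x₁) * (h - x₃) * (h - x₄) +
      (h - x₁) * (h - x₂) * (h - x₄) + (h - x₁) * (h - x₂) * (h - x₃) = 0 := by
    linear_combination (2 / 3) * H (h + 1) - (2 / 3) * H (h - 1) - (1 / 12) * H (h + 2) +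
      (1 / 12) * H (h - 2)
  simp only [mul_eq_zero, sub_eq_zero] at hroot
  rcases hroot with ((rfl | rfl) | rfl) | rfl <;>
    simp [sub_eq_zero, h12, h13, h14, h23, h24, h34, h12.symm, h13.symm, h14.symm, h23.symm,
      h24.symm, h34.symm] at hderiv

/-- Two quadruples of distinct numbers with matching elementary symmetric functions cannot have
vanishing total power sums of orders `2`, `4`, `8` and `-2`. -/
theorem no_balanced_quadruples {x₁ x₂ x₃ x₄ y₁ y₂ y₃ y₄ : ℂ}
    (hx12 : x₁ ≠ x₂) (hx13 : x₁ ≠ x₃) (hx14 : x₁ ≠ x₄) (hx23 : x₂ ≠ x₃) (hx24 : x₂ ≠ x₄)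
    (hx34 : x₃ ≠ x₄)
    (hy12 : y₁ ≠ y₂) (hy13 : y₁ ≠ y₃) (hy14 : y₁ ≠ y₄) (hy23 : y₂ ≠ y₃) (hy24 : y₂ ≠ y₄)
    (hy34 : y₃ ≠ y₄)
    (hx0 : x₁ * x₂ * x₃ * x₄ ≠ 0)
    (e1 : y₁ + y₂ + y₃ + y₄ = -(x₁ + x₂ + x₃ + x₄))
    (e3 : y₁ * y₂ * y₃ + y₁ * y₂ * y₄ + y₁ * y₃ * y₄ + y₂ * y₃ * y₄ =
      -(x₁ * x₂ * x₃ + x₁ * x₂ * x₄ + x₁ * x₃ * x₄ + x₂ * x₃ * x₄))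
    (e4 : y₁ * y₂ * y₃ * y₄ = x₁ * x₂ * x₃ * x₄)
    (p2 : x₁ ^ 2 + x₂ ^ 2 + x₃ ^ 2 + x₄ ^ 2 + (y₁ ^ 2 + y₂ ^ 2 + y₃ ^ 2 + y₄ ^ 2) = 0)
    (p4 : x₁ ^ 4 + x₂ ^ 4 + x₃ ^ 4 + x₄ ^ 4 + (y₁ ^ 4 + y₂ ^ 4 + y₃ ^ 4 + y₄ ^ 4) = 0)
    (p8 : x₁ ^ 8 + x₂ ^ 8 + x₃ ^ 8 + x₄ ^ 8 + (y₁ ^ 8 + y₂ ^ 8 + y₃ ^ 8 + y₄ ^ 8) = 0)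
    (pm2 : x₁⁻¹ ^ 2 + x₂⁻¹ ^ 2 + x₃⁻¹ ^ 2 + x₄⁻¹ ^ 2 +
      (y₁⁻¹ ^ 2 + y₂⁻¹ ^ 2 + y₃⁻¹ ^ 2 + y₄⁻¹ ^ 2) = 0) : False := by
  obtain ⟨u, hu⟩ : ∃ u, u = x₁ + x₂ + x₃ + x₄ := ⟨_, rfl⟩
  obtain ⟨v, hv⟩ : ∃ v, v = x₁ * x₂ + x₁ * x₃ + x₁ * x₄ + x₂ * x₃ + x₂ * x₄ + x₃ * x₄ := ⟨_, rfl⟩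
  obtain ⟨v', hv'⟩ : ∃ v, v = y₁ * y₂ + y₁ * y₃ + y₁ * y₄ + y₂ * y₃ + y₂ * y₄ + y₃ * y₄ := ⟨_, rfl⟩
  obtain ⟨w, hw⟩ : ∃ w, w = x₁ * x₂ * x₃ + x₁ * x₂ * x₄ + x₁ * x₃ * x₄ + x₂ * x₃ * x₄ := ⟨_, rfl⟩
  obtain ⟨q, hq⟩ : ∃ q, q = x₁ * x₂ * x₃ * x₄ := ⟨_, rfl⟩
  have hFx : ∀ X, (X - x₁) * (X - x₂) * (X - x₃) * (X - x₄) =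
      X ^ 4 - u * X ^ 3 + v * X ^ 2 - w * X + q := by
    intro X; rw [hu, hv, hw, hq]; ring
  rw [← hu] at e1
  rw [← hw] at e3
  rw [← hq] at e4 hx0
  have hFy : ∀ X, (X - y₁) * (X - y₂) * (X - y₃) * (X - y₄) =
      X ^ 4 + u * X ^ 3 + v' * X ^ 2 + w * X + q := by
    intro X; rw [hv']; linear_combination (-X ^ 3) * e1 - X * e3 + e4
  have power_sums : ∀ a b c d e₁ e₂ e₃ e₄ : ℂ, e₁ = a + b + c + d →
      e₂ = a * b + a * c + a * d + b * c + b * d + c * d →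
      e₃ = a * b * c + a * b * d + a * c * d + b * c * d → e₄ = a * b * c * d →
      a ^ 2 + b ^ 2 + c ^ 2 + d ^ 2 = e₁ ^ 2 - 2 * e₂ ∧
      a ^ 4 + b ^ 4 + c ^ 4 + d ^ 4 =
        e₁ ^ 4 - 4 * e₁ ^ 2 * e₂ + 2 * e₂ ^ 2 + 4 * e₁ * e₃ - 4 * e₄ ∧
      (e₄ ≠ 0 → a⁻¹ ^ 2 + b⁻¹ ^ 2 + c⁻¹ ^ 2 + d⁻¹ ^ 2 = (e₃ ^ 2 - 2 * e₂ * e₄) / e₄ ^ 2) := by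
    rintro a b c d _ _ _ _ rfl rfl rfl rfl
    refine ⟨by ring, by ring, fun h => ?_⟩
    have ha : a ≠ 0 := by rintro rfl; simp at h
    have hb : b ≠ 0 := by rintro rfl; simp at h
    have hc : c ≠ 0 := by rintro rfl; simp at h
    have hd : d ≠ 0 := by rintro rfl; simp at h
    field_simp
    ring
  have squares : ∀ a b c d e₁ e₂ e₃ e₄ : ℂ, e₁ = a + b + c + d →
      e₂ = a * b + a * c + a * d + b * c + b * d + c * d →
      e₃ = a * b * c + a * b * d + a * c * d + b * c * d → e₄ = a * b * c * d →
      a ^ 8 + b ^ 8 + c ^ 8 + d ^ 8 =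
        (e₁ ^ 2 - 2 * e₂) ^ 4 - 4 * (e₁ ^ 2 - 2 * e₂) ^ 2 * (e₂ ^ 2 - 2 * e₁ * e₃ + 2 * e₄) +
          2 * (e₂ ^ 2 - 2 * e₁ * e₃ + 2 * e₄) ^ 2 +
          4 * (e₁ ^ 2 - 2 * e₂) * (e₃ ^ 2 - 2 * e₂ * e₄) - 4 * e₄ ^ 2 := by
    rintro a b c d _ _ _ _ rfl rfl rfl rfl
    ring
  obtain ⟨sx2, sx4, sxm⟩ := power_sums x₁ x₂ x₃ x₄ u v w q hu hv hw hq
  obtain ⟨sy2, sy4, sym⟩ := power_sums y₁ y₂ y₃ y₄ (-u) v' (-w) q e1.symm hv' e3.symm e4.symm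
  have sx8 := squares x₁ x₂ x₃ x₄ u v w q hu hv hw hq
  have sy8 := squares y₁ y₂ y₃ y₄ (-u) v' (-w) q e1.symm hv' e3.symm e4.symm
  rw [sx2, sy2] at p2
  rw [sx4, sy4] at p4
  rw [sx8, sy8] at p8
  rw [sxm hx0, sym hx0, ← add_div, div_eq_zero_iff] at pm2
  have pm2 := pm2.resolve_right (pow_ne_zero 2 hx0)
  have r2 : v' = u ^ 2 - v := by linear_combination (-1 / 2) * p2
  subst r2
  have r4 : v * (u ^ 2 - v) = 2 * u * w - 2 * q := by linear_combination (-1 / 4) * p4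
  have rm : w ^ 2 = q * u ^ 2 := by linear_combination (1 / 2) * pm2
  have r8 : u * w * (2 * v - u ^ 2) ^ 2 = q ^ 2 := by
    have hV : v ^ 2 - 2 * u * w + 2 * q = v * (2 * v - u ^ 2) := by linear_combination r4
    have hV' : (u ^ 2 - v) ^ 2 - 2 * -u * -w + 2 * q = (v - u ^ 2) * (2 * v - u ^ 2) := by
      linear_combination r4
    have hW : w ^ 2 - 2 * v * q = -q * (2 * v - u ^ 2) := by linear_combination rm
    have hW' : (-w) ^ 2 - 2 * (u ^ 2 - v) * q = q * (2 * v - u ^ 2) := by linear_combination rm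
    rw [hV, hV', hW, hW'] at p8
    linear_combination (1 / 8) * p8 - (1 / 2) * (2 * v - u ^ 2) ^ 2 * r4
  have hu0 : u ≠ 0 := by
    rintro rfl
    exact hx0 (by simpa using r8.symm)
  obtain ⟨θ, hθ⟩ : ∃ θ, θ = w / u := ⟨_, rfl⟩
  have hwθ : w = θ * u := by rw [hθ]; field_simp
  have hqθ : q = θ ^ 2 := by
    have : u ^ 2 * (q - θ ^ 2) = 0 := by rw [hwθ] at rm; linear_combination -rm
    have := (mul_eq_zero.1 this).resolve_left (pow_ne_zero 2 hu0)
    linear_combination this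
  have hθ0 : θ ≠ 0 := by rintro rfl; simp [hqθ] at hx0
  subst hqθ
  subst hwθ
  have key : (u ^ 2 - θ) * (u ^ 4 - 7 * θ * u ^ 2 + θ ^ 2) = 0 := by
    have : θ * ((u ^ 2 - θ) * (u ^ 4 - 7 * θ * u ^ 2 + θ ^ 2)) = 0 := by
      linear_combination r8 + 4 * θ * u ^ 2 * r4
    exact (mul_eq_zero.1 this).resolve_left hθ0
  rcases mul_eq_zero.1 key with hk | hk
  · have hθu : θ = u ^ 2 := by linear_combination -hk
    subst hθu
    have : v * (u ^ 2 - v) = 0 := by linear_combination r4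
    rcases mul_eq_zero.1 this with hv0 | hv0
    · refine false_of_double_root (h := u) (k := -u) hx12 hx13 hx14 hx23 hx24 hx34 fun X => ?_
      rw [hFx, hv0]; ring
    · refine false_of_double_root (h := -u) (k := u) hy12 hy13 hy14 hy23 hy24 hy34 fun X => ?_
      rw [hFy, hv0]; ring
  · obtain ⟨h, hh⟩ : ∃ h, h = (u ^ 2 + θ) / (3 * u) := ⟨_, rfl⟩
    have hh1 : 3 * u * h = u ^ 2 + θ := by rw [hh]; field_simp
    have hh2 : θ = h ^ 2 := by
      have : 9 * u ^ 2 * (θ - h ^ 2) = 0 := by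
        linear_combination (-(3 * u * h + (u ^ 2 + θ))) * hh1 - hk
      have := (mul_eq_zero.1 this).resolve_left (by simpa using hu0)
      linear_combination this
    subst hh2
    have : (v - (2 * u * h - 2 * h ^ 2)) * (v - (h ^ 2 + u * h)) = 0 := by
      linear_combination (-1) * r4 - v * hh1
    rcases mul_eq_zero.1 this with hv0 | hv0
    · refine false_of_double_root (h := h) (k := u - 2 * h) hx12 hx13 hx14 hx23 hx24 hx34
        fun X => ?_
      rw [hFx]; linear_combination X ^ 2 * hv0
    · refine false_of_double_root (h := -h) (k := 2 * h - u) hy12 hy13 hy14 hy23 hy24 hy34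
        fun X => ?_
      rw [hFy]; linear_combination -X ^ 2 * hv0 - X ^ 2 * hh1

theorem card_le_three_of_cubic {S : Finset ℂ} {a b c d : ℂ} (h0 : a ≠ 0 ∨ b ≠ 0 ∨ c ≠ 0 ∨ d ≠ 0)
    (h : ∀ s ∈ S, a * s ^ 3 + b * s ^ 2 + c * s + d = 0) : S.card ≤ 3 := by
  open Polynomial in
  have hne : (C a * X ^ 3 + C b * X ^ 2 + C c * X + C d : ℂ[X]) ≠ 0 := by
    intro h
    have h0' := congrArg (coeff · 0) h
    have h1' := congrArg (coeff · 1) h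
    have h2' := congrArg (coeff · 2) h
    have h3' := congrArg (coeff · 3) h
    simp [coeff_X, coeff_C] at h0' h1' h2' h3'
    simp [h0', h1', h2', h3'] at h0
  refine (Polynomial.card_le_degree_of_subset_roots
    (p := (C a * X ^ 3 + C b * X ^ 2 + C c * X + C d : ℂ[X]))
    fun s hs => ?_).trans Polynomial.natDegree_cubic_le
  simpa [hne] using h s hs

theorem RootPowerMap.sum_eight_sq {m : ℕ} (E : RootPowerMap m 2) {a b c d e f g h : ℂ}
    (ha : a ^ m = 1) (hb : b ^ m = 1) (hc : c ^ m = 1) (hd : d ^ m = 1)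
    (he : e ^ m = 1) (hf : f ^ m = 1) (hg : g ^ m = 1) (hh : h ^ m = 1)
    (hsum : a + b + c + d + (e + f + g + h) = 0) :
    a ^ 2 + b ^ 2 + c ^ 2 + d ^ 2 + (e ^ 2 + f ^ 2 + g ^ 2 + h ^ 2) = 0 := by
  have := E.sum_map_root Finset.univ ![a, b, c, d, e, f, g, h]
    (by simp [Fin.forall_fin_succ, ha, hb, hc, hd, he, hf, hg, hh])
    (by simp [Fin.sum_univ_eight]; linear_combination hsum)
  simp [Fin.sum_univ_eight] at this
  linear_combination this

/-- The equation satisfied by the product `s` of the endpoints of a chord through `p`, where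
`r` is the conjugate of `p`, and `P` and `R` are the images of `p` and `r` under the map that
squares the `m`-th roots of unity. The three cases are those of both endpoints being `m`-th roots
of unity, both being negatives of such roots, and one of each kind. -/
def ChordEquation (m : ℕ) (p r P R s : ℂ) : Prop :=
  s ^ m = 1 ∧ (R - r ^ 2) * s ^ 2 + 2 * (1 - p * r) * s + (P - p ^ 2) = 0 ∨
  s ^ m = 1 ∧ (R + r ^ 2) * s ^ 2 - 2 * (1 - p * r) * s + (P + p ^ 2) = 0 ∨
  (-s) ^ m = 1 ∧ (P - s ^ 2 * R) ^ 2 = ((p + s * r) ^ 2 - 4 * s) * (p + s * r) ^ 2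

theorem RootPowerMap.map_root_of_pow_two_mul {m : ℕ} (hm : Odd m) (E : RootPowerMap m 2) {x : ℂ}
    (hx : x ^ (2 * m) = 1) :
    x ∈ E.K ∧ (x ^ m = 1 ∧ E.φ x = x ^ 2 ∨ x ^ m = -1 ∧ E.φ x = -x ^ 2) := by
  have : (x ^ m) ^ 2 = 1 := by rw [← pow_mul, mul_comm, hx]
  rcases sq_eq_one_iff.1 this with h | h
  · exact ⟨E.mem x h, .inl ⟨h, E.map_root x h⟩⟩
  · have h' : (-x) ^ m = 1 := by rw [hm.neg_pow, h, neg_neg]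
    have hK : x ∈ E.K := by simpa using E.K.neg_mem (E.mem _ h')
    refine ⟨hK, .inr ⟨h, ?_⟩⟩
    have h2 := E.map_root _ h'
    rw [E.map_neg hK] at h2
    linear_combination -h2

open ComplexConjugate in
theorem IsChordProduct.chordEquation {m : ℕ} (hm : Odd m) (E : RootPowerMap m 2) {p s : ℂ}
    (hp : p ∈ E.K) (hr : conj p ∈ E.K) (hs : IsChordProduct p (2 * m) s) :
    ChordEquation m p (conj p) (E.φ p) (E.φ (conj p)) s := by
  obtain ⟨x, y, hx, hy, rfl, -, h⟩ := hs
  obtain ⟨hxK, hx⟩ := E.map_root_of_pow_two_mul hm hx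
  obtain ⟨hyK, hy⟩ := E.map_root_of_pow_two_mul hm hy
  have hφ := E.map_line hp hr hxK hyK h
  rcases hx with ⟨hx, hφx⟩ | ⟨hx, hφx⟩ <;> rcases hy with ⟨hy, hφy⟩ | ⟨hy, hφy⟩ <;>
    rw [hφx, hφy] at hφ
  · refine .inl ⟨by rw [mul_pow, hx, hy, one_mul], ?_⟩
    linear_combination (x + y + p + x * y * conj p) * h - hφ
  · refine .inr (.inr ⟨by rw [hm.neg_pow, mul_pow, hx, hy]; ring, ?_⟩)
    rw [← h]
    linear_combination (-(x ^ 2 - y ^ 2) - (E.φ p - (x * y) ^ 2 * E.φ (conj p))) * hφ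
  · refine .inr (.inr ⟨by rw [hm.neg_pow, mul_pow, hx, hy]; ring, ?_⟩)
    rw [← h]
    linear_combination ((x ^ 2 - y ^ 2) - (E.φ p - (x * y) ^ 2 * E.φ (conj p))) * hφ
  · refine .inr (.inl ⟨by rw [mul_pow, hx, hy]; ring, ?_⟩)
    linear_combination -(x + y + p + x * y * conj p) * h - hφ

section ChordEquation

variable {m : ℕ} {p r P R : ℂ}

theorem exists_chordEquation_cover (hp : p ≠ 0) (hpr : p * r ≠ 1) {S : Finset ℂ}
    (hS : ∀ s ∈ S, ChordEquation m p r P R s) :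
    ∃ A B Q : Finset ℂ, S ⊆ A ∪ B ∪ Q ∧ A.card ≤ 2 ∧ B.card ≤ 2 ∧ Q.card ≤ 4 ∧
      (∀ s ∈ A, s ^ m = 1 ∧ (R - r ^ 2) * s ^ 2 + 2 * (1 - p * r) * s + (P - p ^ 2) = 0) ∧
      (∀ s ∈ B, s ^ m = 1 ∧ (R + r ^ 2) * s ^ 2 - 2 * (1 - p * r) * s + (P + p ^ 2) = 0) ∧
      (∀ s ∈ Q, (-s) ^ m = 1 ∧
        (P - s ^ 2 * R) ^ 2 = ((p + s * r) ^ 2 - 4 * s) * (p + s * r) ^ 2) := by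
  classical
  have hpr' : 1 - p * r ≠ 0 := sub_ne_zero.2 hpr.symm
  refine ⟨S.filter fun s => s ^ m = 1 ∧
      (R - r ^ 2) * s ^ 2 + 2 * (1 - p * r) * s + (P - p ^ 2) = 0,
    S.filter fun s => s ^ m = 1 ∧ (R + r ^ 2) * s ^ 2 - 2 * (1 - p * r) * s + (P + p ^ 2) = 0,
    S.filter fun s => (-s) ^ m = 1 ∧
      (P - s ^ 2 * R) ^ 2 = ((p + s * r) ^ 2 - 4 * s) * (p + s * r) ^ 2,
    ?_, ?_, ?_, ?_, fun s hs => (Finset.mem_filter.1 hs).2, fun s hs => (Finset.mem_filter.1 hs).2,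
    fun s hs => (Finset.mem_filter.1 hs).2⟩
  · intro s hs
    simp only [Finset.mem_union, Finset.mem_filter, hs, true_and, or_assoc]
    exact hS s hs
  · exact card_le_two_of_quadratic (.inr (.inl (mul_ne_zero two_ne_zero hpr')))
      fun s hs => (Finset.mem_filter.1 hs).2.2
  · refine card_le_two_of_quadratic (a := R + r ^ 2) (b := -2 * (1 - p * r)) (c := P + p ^ 2)
      (.inr (.inl (mul_ne_zero (by norm_num) hpr'))) fun s hs => ?_
    linear_combination (Finset.mem_filter.1 hs).2.2
  · refine card_le_four_of_quartic (a := R ^ 2 - r ^ 4) (b := 4 * r ^ 2 * (1 - p * r))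
      (c := -2 * P * R - 6 * p ^ 2 * r ^ 2 + 8 * p * r) (d := 4 * p ^ 2 * (1 - p * r))
      (e := P ^ 2 - p ^ 4)
      (mul_ne_zero (mul_ne_zero (by norm_num) (pow_ne_zero 2 hp)) hpr') fun s hs => ?_
    linear_combination (Finset.mem_filter.1 hs).2.2

theorem false_of_eight_chordEquation (E : RootPowerMap m 2) (hm : m ≠ 0)
    (hp : p ≠ 0) (hpr : p * r ≠ 1) {S : Finset ℂ} (hcard : 8 ≤ S.card)
    (hS : ∀ s ∈ S, ChordEquation m p r P R s) : False := by
  classical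
  obtain ⟨A, B, Q, hsub, hA2, hB2, hQ4, hA, hB, hQ⟩ := exists_chordEquation_cover hp hpr hS
  have hpr' : 1 - p * r ≠ 0 := sub_ne_zero.2 hpr.symm
  have h₁ := Finset.card_le_card hsub
  have h₂ := Finset.card_union_le (A ∪ B) Q
  have h₃ := Finset.card_union_le A B
  have hdisj : Disjoint A B := Finset.card_union_eq_card_add_card.1 (by omega)
  obtain ⟨s₁, s₂, h12, rfl⟩ := Finset.card_eq_two.1 (show A.card = 2 by omega)
  obtain ⟨s₃, s₄, h34, rfl⟩ := Finset.card_eq_two.1 (show B.card = 2 by omega)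
  have hQcard : Q.card = 4 := by omega
  simp only [Finset.disjoint_insert_left, Finset.disjoint_singleton_left, Finset.mem_insert,
    Finset.mem_singleton, not_or] at hdisj
  obtain ⟨⟨h13, h14⟩, h23, h24⟩ := hdisj
  obtain ⟨m1, q1⟩ := hA s₁ (by simp)
  obtain ⟨m2, q2⟩ := hA s₂ (by simp)
  obtain ⟨m3, q3⟩ := hB s₃ (by simp)
  obtain ⟨m4, q4⟩ := hB s₄ (by simp)
  obtain ⟨α, hα⟩ : ∃ α, α = R - r ^ 2 := ⟨_, rfl⟩
  obtain ⟨β, hβ⟩ : ∃ β, β = R + r ^ 2 := ⟨_, rfl⟩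
  rw [← hα] at q1 q2
  rw [← hβ] at q3 q4
  have sA : α * (s₁ + s₂) = -2 * (1 - p * r) :=
    mul_left_cancel₀ (sub_ne_zero.2 h12) (by linear_combination q1 - q2)
  have sB : β * (s₃ + s₄) = 2 * (1 - p * r) :=
    mul_left_cancel₀ (sub_ne_zero.2 h34) (by linear_combination q3 - q4)
  have tA : α * (s₁ * s₂) = P - p ^ 2 := by linear_combination s₁ * sA - q1
  have tB : β * (s₃ * s₄) = P + p ^ 2 := by linear_combination s₃ * sB - q3
  have hα0 : α ≠ 0 := by
    rintro rfl
    exact mul_ne_zero (show (-2 : ℂ) ≠ 0 by norm_num) hpr' (by rw [← sA, zero_mul])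
  have hβ0 : β ≠ 0 := by
    rintro rfl
    exact mul_ne_zero (two_ne_zero (α := ℂ)) hpr' (by rw [← sB, zero_mul])
  have hprod : ∀ z, (P - z ^ 2 * R) ^ 2 = ((p + z * r) ^ 2 - 4 * z) * (p + z * r) ^ 2 →
      (z - s₁) * (z - s₂) * (z - s₃) * (z - s₄) = 4 * (P * R - 1) / (α * β) * z ^ 2 := by
    intro z hz
    have e1 : α * ((z - s₁) * (z - s₂)) =
        (R - r ^ 2) * z ^ 2 + 2 * (1 - p * r) * z + (P - p ^ 2) := by
      linear_combination -z * sA + tA + z ^ 2 * hα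
    have e2 : β * ((z - s₃) * (z - s₄)) =
        (R + r ^ 2) * z ^ 2 - 2 * (1 - p * r) * z + (P + p ^ 2) := by
      linear_combination -z * sB + tB + z ^ 2 * hβ
    have : (α * ((z - s₁) * (z - s₂))) * (β * ((z - s₃) * (z - s₄))) =
        4 * (P * R - 1) * z ^ 2 := by
      rw [e1, e2]; linear_combination hz
    field_simp
    linear_combination this
  obtain ⟨z₁, Q', hz₁, rfl, hQ'⟩ := Finset.card_eq_succ.1 hQcard
  obtain ⟨z₂, z₃, z₄, z23, z24, z34, rfl⟩ := Finset.card_eq_three.1 hQ'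
  simp only [Finset.mem_insert, Finset.mem_singleton, not_or] at hz₁
  obtain ⟨z12, z13, z14⟩ := hz₁
  obtain ⟨n1, w1⟩ := hQ z₁ (by simp)
  obtain ⟨n2, w2⟩ := hQ z₂ (by simp)
  obtain ⟨n3, w3⟩ := hQ z₃ (by simp)
  obtain ⟨n4, w4⟩ := hQ z₄ (by simp)
  obtain ⟨c, hc⟩ : ∃ c, c = 4 * (P * R - 1) / (α * β) := ⟨_, rfl⟩
  rw [← hc] at hprod
  have hcubic : z₁ + z₂ + z₃ + z₄ = s₁ + s₂ + s₃ + s₄ ∧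
      z₁ * z₂ * z₃ + z₁ * z₂ * z₄ + z₁ * z₃ * z₄ + z₂ * z₃ * z₄ =
        s₁ * s₂ * s₃ + s₁ * s₂ * s₄ + s₁ * s₃ * s₄ + s₂ * s₃ * s₄ ∧
      z₁ * z₂ * z₃ * z₄ = s₁ * s₂ * s₃ * s₄ := by
    by_contra hcon
    have := card_le_three_of_cubic (S := {z₁, z₂, z₃, z₄})
      (a := z₁ + z₂ + z₃ + z₄ - (s₁ + s₂ + s₃ + s₄))
      (b := s₁ * s₂ + s₁ * s₃ + s₁ * s₄ + s₂ * s₃ + s₂ * s₄ + s₃ * s₄ -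
        (z₁ * z₂ + z₁ * z₃ + z₁ * z₄ + z₂ * z₃ + z₂ * z₄ + z₃ * z₄) - c)
      (c := z₁ * z₂ * z₃ + z₁ * z₂ * z₄ + z₁ * z₃ * z₄ + z₂ * z₃ * z₄ -
        (s₁ * s₂ * s₃ + s₁ * s₂ * s₄ + s₁ * s₃ * s₄ + s₂ * s₃ * s₄))
      (d := s₁ * s₂ * s₃ * s₄ - z₁ * z₂ * z₃ * z₄) ?_ ?_
    · rw [hQcard] at this; omega
    · by_contra! hall
      exact hcon ⟨sub_eq_zero.1 hall.1, sub_eq_zero.1 hall.2.2.1, (sub_eq_zero.1 hall.2.2.2).symm⟩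
    · intro z hz
      have hz' := hprod z (hQ z hz).2
      have : (z - z₁) * (z - z₂) * (z - z₃) * (z - z₄) = 0 := by
        simp only [Finset.mem_insert, Finset.mem_singleton] at hz
        rcases hz with rfl | rfl | rfl | rfl <;> simp
      linear_combination hz' - this
  obtain ⟨e1, e3, e4⟩ := hcubic
  have hne : ∀ z : ℂ, z ^ m = 1 → z ≠ 0 := by
    rintro _ h rfl
    simp [hm] at h
  have hpow : ∀ (j : ℕ) (z : ℂ), z ^ m = 1 → (z ^ j) ^ m = 1 := fun j z h => by
    rw [← pow_mul, mul_comm, pow_mul, h, one_pow]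
  have hinv : ∀ z : ℂ, z ^ m = 1 → z⁻¹ ^ m = 1 := fun z h => by rw [inv_pow, h, inv_one]
  have p2 := E.sum_eight_sq m1 m2 m3 m4 n1 n2 n3 n4 (by linear_combination -e1)
  have p4 := E.sum_eight_sq (hpow 2 _ m1) (hpow 2 _ m2) (hpow 2 _ m3) (hpow 2 _ m4)
    (hpow 2 _ n1) (hpow 2 _ n2) (hpow 2 _ n3) (hpow 2 _ n4) p2
  simp only [← pow_mul] at p4
  have p8 := E.sum_eight_sq (hpow 4 _ m1) (hpow 4 _ m2) (hpow 4 _ m3) (hpow 4 _ m4)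
    (hpow 4 _ n1) (hpow 4 _ n2) (hpow 4 _ n3) (hpow 4 _ n4) p4
  simp only [← pow_mul] at p8
  have hs0 : s₁ * s₂ * s₃ * s₄ ≠ 0 :=
    mul_ne_zero (mul_ne_zero (mul_ne_zero (hne _ m1) (hne _ m2)) (hne _ m3)) (hne _ m4)
  have inv_sum : ∀ a b c d : ℂ, a * b * c * d ≠ 0 → a⁻¹ + b⁻¹ + c⁻¹ + d⁻¹ =
      (a * b * c + a * b * d + a * c * d + b * c * d) / (a * b * c * d) := by
    intro a b c d h
    have ha : a ≠ 0 := by rintro rfl; simp at h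
    have hb : b ≠ 0 := by rintro rfl; simp at h
    have hc : c ≠ 0 := by rintro rfl; simp at h
    have hd : d ≠ 0 := by rintro rfl; simp at h
    field_simp
    ring
  have pm1 : s₁⁻¹ + s₂⁻¹ + s₃⁻¹ + s₄⁻¹ + ((-z₁)⁻¹ + (-z₂)⁻¹ + (-z₃)⁻¹ + (-z₄)⁻¹) = 0 := by
    have hz := inv_sum z₁ z₂ z₃ z₄ (by rwa [e4])
    rw [e3, e4, ← inv_sum s₁ s₂ s₃ s₄ hs0] at hz
    simp only [inv_neg]
    linear_combination -hz
  exact no_balanced_quadruples h12 h13 h14 h23 h24 h34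
    (neg_injective.ne z12) (neg_injective.ne z13) (neg_injective.ne z14) (neg_injective.ne z23)
    (neg_injective.ne z24) (neg_injective.ne z34) hs0
    (by linear_combination -e1) (by linear_combination -e3) (by linear_combination e4) p2 p4 p8
    (E.sum_eight_sq (hinv _ m1) (hinv _ m2) (hinv _ m3) (hinv _ m4)
      (hinv _ n1) (hinv _ n2) (hinv _ n3) (hinv _ n4) pm1)

end ChordEquation

/-- The sum of two distinct roots of unity of odd order is a unit in the algebraic integers. -/
theorem exists_isIntegral_add_mul_eq_one {m : ℕ} (hm : Odd m) {a b : ℂ} (ha : a ^ m = 1)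
    (hb : b ^ m = 1) (hab : a ≠ b) : ∃ g : ℂ, IsIntegral ℤ g ∧ (a + b) * g = 1 := by
  obtain ⟨k, rfl⟩ := hm
  have h_int : ∀ z : ℂ, z ^ (2 * k + 1) = 1 → IsIntegral ℤ z := fun z hz =>
    IsIntegral.of_pow (n := 2 * k + 1) (by omega) (by rw [hz]; exact isIntegral_one)
  have hsq : ∀ z : ℂ, z ^ (2 * k + 1) = 1 → (z ^ 2) ^ (k + 1) = z := fun z hz => by
    rw [← pow_mul, show 2 * (k + 1) = 2 * k + 1 + 1 by ring, pow_succ, hz, one_mul]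
  refine ⟨∑ i ∈ Finset.range (k + 1), (a ^ 2) ^ i * (b ^ 2) ^ (k + 1 - 1 - i),
    IsIntegral.sum _ fun i _ => (((h_int a ha).pow 2).pow i).mul (((h_int b hb).pow 2).pow _), ?_⟩
  refine mul_left_cancel₀ (sub_ne_zero.2 hab) ?_
  have := (Commute.all (a ^ 2) (b ^ 2)).geom_sum₂_mul (k + 1)
  rw [hsq a ha, hsq b hb] at this
  linear_combination this

theorem not_isIntegral_of_two_mul_eq_one {z : ℂ} (hz : 2 * z = 1) : ¬ IsIntegral ℤ z := by
  intro h
  have hz' : z = algebraMap ℚ ℂ (1 / 2) := by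
    rw [map_div₀, map_one, map_ofNat]
    linear_combination (1 / 2) * hz
  rw [hz', isIntegral_algebraMap_iff (algebraMap ℚ ℂ).injective,
    IsIntegrallyClosed.isIntegral_iff] at h
  obtain ⟨y, hy⟩ := h
  have : (2 * y : ℚ) = 1 := by
    rw [show (y : ℚ) = 1 / 2 from hy]; norm_num
  have : 2 * y = 1 := by exact_mod_cast this
  omega

theorem mul_ne_two_mul_of_odd_roots {m : ℕ} (hm : Odd m) {a b x z : ℂ} (ha : a ^ m = 1)
    (hb : b ^ m = 1) (hx : x ^ m = 1) (hz : z ^ m = 1) (hab : a ≠ b) (hxz : x ≠ z) :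
    (a + b) * ((x - z) * (3 * x + z)) ≠ 2 * (x * z * (x + z) ^ 2) := by
  intro h
  obtain ⟨g, hg, hg1⟩ := exists_isIntegral_add_mul_eq_one hm ha hb hab
  obtain ⟨g', hg', hg1'⟩ := exists_isIntegral_add_mul_eq_one hm hx hz hxz
  have h_int : ∀ z : ℂ, z ^ m = 1 → IsIntegral ℤ z := fun z hz =>
    IsIntegral.of_pow hm.pos (by rw [hz]; exact isIntegral_one)
  have ha := h_int a ha
  have hb := h_int b hb
  have hx := h_int x hx
  have hz := h_int z hz
  have h2 : IsIntegral ℤ (2 : ℂ) := by simpa using isIntegral_algebraMap (R := ℤ) (A := ℂ) (x := 2)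
  refine not_isIntegral_of_two_mul_eq_one
    (z := g * g' ^ 2 * (x * z * (x + z) ^ 2 - (a + b) * (x ^ 2 - 2 * (x * z) - z ^ 2))) ?_
    ((hg.mul (hg'.pow 2)).mul (((hx.mul hz).mul ((hx.add hz).pow 2)).sub
      ((ha.add hb).mul (((hx.pow 2).sub (h2.mul (hx.mul hz))).sub (hz.pow 2)))))
  have h1 : (a + b) * g * ((x + z) * g') ^ 2 = 1 := by rw [hg1, hg1']; ring
  linear_combination h1 - g * g' ^ 2 * h

open ComplexConjugate in
/-- Reflection in the line through `0` and `p` permutes the chords through `p`. -/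
theorem IsChordProduct.reflect {p s t : ℂ} {M : ℕ} (hM : M ≠ 0) (hev : Even M) (ht : t ^ M = 1)
    (hpt : p + t * conj p = 0) (hs : IsChordProduct p M s) :
    IsChordProduct p M (t ^ 2 / s) := by
  have hne : ∀ z : ℂ, z ^ M = 1 → z ≠ 0 := by
    rintro _ h rfl
    simp [hM] at h
  obtain ⟨x, y, hx, hy, rfl, h0, h⟩ := hs
  have hx0 := hne x hx
  have hy0 := hne y hy
  have hsum : -t / x + -t / y = -t * (x + y) / (x * y) := by field_simp; ring
  refine ⟨-t / x, -t / y, by rw [div_pow, hev.neg_pow, ht, hx, div_one],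
    by rw [div_pow, hev.neg_pow, ht, hy, div_one], by field_simp, ?_, ?_⟩
  · rw [hsum]
    exact div_ne_zero (mul_ne_zero (neg_ne_zero.2 (hne t ht)) h0) (mul_ne_zero hx0 hy0)
  · rw [hsum, h]
    field_simp
    linear_combination (-(x * y) - t) * hpt

theorem exists_eq_of_odd_card {S : Finset ℂ} (hodd : Odd S.card) (g : ℂ → ℂ)
    (hg : ∀ s ∈ S, g s ∈ S) (hgg : ∀ s ∈ S, g (g s) = s) : ∃ s ∈ S, g s = s := by
  by_contra! hcon
  have : ∑ _s ∈ S, (1 : ZMod 2) = 0 :=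
    Finset.sum_involution (fun s _ => g s) (fun _ _ => by decide)
      (fun s hs _ => hcon s hs) (fun s hs => hg s hs) (fun s hs => hgg s hs)
  rw [Finset.sum_const, nsmul_eq_mul, mul_one, ZMod.natCast_eq_zero_iff] at this
  exact (Nat.not_even_iff_odd.2 hodd) (even_iff_two_dvd.2 this)

open ComplexConjugate in
theorem not_isChordProduct_of_diameter {m : ℕ} (hm : Odd m) (E : RootPowerMap m 2) {p t : ℂ}
    (hp0 : p ≠ 0) (hpr : p * conj p ≠ 1) (hp : p ∈ E.K) (hr : conj p ∈ E.K) (ht : t ^ m = 1)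
    (hpt : p + t * conj p = 0) {N : Finset ℂ} (hcard : 7 ≤ N.card)
    (hN : ∀ s ∈ N, IsChordProduct p (2 * m) s) : False := by
  classical
  have hm0 : m ≠ 0 := hm.pos.ne'
  have hne : ∀ z : ℂ, z ^ (2 * m) = 1 → z ≠ 0 := by
    rintro _ h rfl
    simp [hm0] at h
  have ht2 : t ^ (2 * m) = 1 := by rw [mul_comm, pow_mul, ht, one_pow]
  have ht0 := hne t ht2
  have hs0 : ∀ s, IsChordProduct p (2 * m) s → s ≠ 0 := by
    rintro _ ⟨x, y, hx, hy, rfl, -⟩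
    exact mul_ne_zero (hne x hx) (hne y hy)
  have hN' : ∀ s ∈ N ∪ N.image (t ^ 2 / ·), IsChordProduct p (2 * m) s := by
    intro s hs
    rcases Finset.mem_union.1 hs with hs | hs
    · exact hN s hs
    · obtain ⟨s, hsN, rfl⟩ := Finset.mem_image.1 hs
      exact (hN s hsN).reflect (by omega) (even_two_mul m) ht2 hpt
  have hlt : (N ∪ N.image (t ^ 2 / ·)).card < 8 := by
    by_contra! h
    exact false_of_eight_chordEquation E hm0 hp0 hpr h fun s hs =>
      (hN' s hs).chordEquation hm E hp hr
  have heq : N = N ∪ N.image (t ^ 2 / ·) :=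
    Finset.eq_of_subset_of_card_le Finset.subset_union_left (by omega)
  have hNcard : N.card = 7 := by rw [← heq] at hlt; omega
  obtain ⟨s, hs, hfix⟩ := exists_eq_of_odd_card (S := N) (by rw [hNcard]; decide) (t ^ 2 / ·)
    (fun s hs => by rw [heq]; exact Finset.mem_union_right _ (Finset.mem_image_of_mem _ hs))
    (fun s hs => by have := hs0 s (hN s hs); field_simp)
  obtain ⟨x, z, hx, hz, hxz, hprod, hdiff⟩ :
      ∃ x z : ℂ, x ^ m = 1 ∧ z ^ m = 1 ∧ x ≠ z ∧ x * z = t ∧ x - z = 2 * p := by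
    have hsq : s ^ 2 = t ^ 2 := by
      have := hs0 s (hN s hs)
      rw [div_eq_iff this] at hfix
      rw [hfix, sq]
    obtain ⟨x, y, hx, hy, hxy, h0, h⟩ := hN s hs
    rcases sq_eq_sq_iff_eq_or_eq_neg.1 hsq with rfl | rfl
    · exact absurd (h.trans hpt) h0
    have h : x + y = 2 * p := by linear_combination h - hpt
    have hneg : ∀ z : ℂ, z ^ m = -1 → (-z) ^ m = 1 := fun z hz => by rw [hm.neg_pow, hz, neg_neg]
    have hpm : x ^ m * y ^ m = -1 := by rw [← mul_pow, hxy, hm.neg_pow, ht]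
    have h20 : 2 * p ≠ 0 := mul_ne_zero two_ne_zero hp0
    rcases (E.map_root_of_pow_two_mul hm hx).2 with ⟨hx1, -⟩ | ⟨hx1, -⟩
    · refine ⟨x, -y, hx1, hneg y (by rw [hx1, one_mul] at hpm; exact hpm), ?_,
        by linear_combination -hxy, by linear_combination h⟩
      rintro hxy'
      exact h0 (by rw [hxy']; ring)
    · refine ⟨y, -x, by rw [hx1] at hpm; linear_combination -hpm, hneg x hx1, ?_,
        by linear_combination -hxy, by linear_combination h⟩
      rintro hxy'
      exact h0 (by rw [hxy']; ring)
  have hP : x ^ 2 - z ^ 2 = 2 * E.φ p := by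
    have h1 := E.map_add x (E.mem x hx) (-z) (E.K.neg_mem (E.mem z hz))
    have h2 := E.map_add p hp p hp
    rw [E.map_neg (E.mem z hz), E.map_root x hx, E.map_root z hz, ← sub_eq_add_neg, hdiff,
      two_mul, h2] at h1
    linear_combination -h1
  have hR : E.φ p + t ^ 2 * E.φ (conj p) = 0 := by
    rw [← E.map_root t ht, ← E.map_mul t (E.mem t ht) _ hr,
      ← E.map_add p hp _ (E.K.mul_mem (E.mem t ht) hr), hpt, E.map_zero]
  obtain ⟨A, B, Q, hsub, -, -, hQ4, hA, hB, -⟩ := exists_chordEquation_cover hp0 hpr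
    fun s hs => (hN s hs).chordEquation hm E hp hr
  have h₁ := Finset.card_le_card hsub
  have h₂ := Finset.card_union_le (A ∪ B) Q
  have h₃ := Finset.card_union_le A B
  rcases (show 1 < A.card ∨ 1 < B.card by omega) with h | h
  · obtain ⟨a, ha, b, hb, hab⟩ := Finset.one_lt_card.1 h
    obtain ⟨am, aq⟩ := hA a ha
    obtain ⟨bm, bq⟩ := hA b hb
    have key : (E.φ (conj p) - conj p ^ 2) * (a + b) + 2 * (1 - p * conj p) = 0 :=
      mul_left_cancel₀ (sub_ne_zero.2 hab) (by linear_combination aq - bq)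
    refine mul_ne_two_mul_of_odd_roots hm am bm hx hz hab hxz ?_
    subst hprod
    linear_combination -4 * (x * z) ^ 2 * key + 4 * (a + b) * hR +
      (4 * (a + b) * (p - x * z * conj p) - 8 * (x * z) * p) * hpt + 2 * (a + b) * hP +
      (a + b - 2 * (x * z)) * (x - z + 2 * p) * hdiff
  · obtain ⟨a, ha, b, hb, hab⟩ := Finset.one_lt_card.1 h
    obtain ⟨am, aq⟩ := hB a ha
    obtain ⟨bm, bq⟩ := hB b hb
    have key : (E.φ (conj p) + conj p ^ 2) * (a + b) - 2 * (1 - p * conj p) = 0 :=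
      mul_left_cancel₀ (sub_ne_zero.2 hab) (by linear_combination aq - bq)
    refine mul_ne_two_mul_of_odd_roots hm am bm hz hx hab hxz.symm ?_
    subst hprod
    linear_combination 4 * (x * z) ^ 2 * key - 4 * (a + b) * hR +
      (4 * (a + b) * (p - x * z * conj p) - 8 * (x * z) * p) * hpt - 2 * (a + b) * hP +
      (a + b - 2 * (x * z)) * (x - z + 2 * p) * hdiff

open ComplexConjugate in
theorem false_of_eight_of_odd {m : ℕ} (hm : Odd m) {p : ℂ} (hp0 : p ≠ 0) (hp : ‖p‖ < 1)
    {S : Finset ℂ} (hcard : 8 ≤ S.card)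
    (hS : ∀ s ∈ S, IsOfFinOrder s ∧ (p + s * conj p = 0 ∨ IsChordProduct p (2 * m) s)) :
    False := by
  classical
  obtain ⟨E⟩ := RootPowerMap.nonempty hm.pos (Nat.coprime_two_left.2 hm)
  have hpr : p * conj p ≠ 1 := by
    intro h
    have h := congrArg norm h
    rw [norm_mul, RCLike.norm_conj, norm_one] at h
    nlinarith [norm_nonneg p]
  have hr0 : conj p ≠ 0 := by simpa using hp0
  have hfield : ∀ N : Finset ℂ, 1 < N.card → (∀ s ∈ N, IsChordProduct p (2 * m) s) →
      p ∈ E.K ∧ conj p ∈ E.K := by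
    intro N hN hN'
    obtain ⟨a, ha, b, hb, hab⟩ := Finset.one_lt_card.1 hN
    exact (hN' a ha).mem_field E (fun z hz => (E.map_root_of_pow_two_mul hm hz).1) (hN' b hb) hab
  by_cases hdiam : ∃ t ∈ S, p + t * conj p = 0
  · obtain ⟨t, htS, hpt⟩ := hdiam
    have hN : ∀ s ∈ S.erase t, IsChordProduct p (2 * m) s := by
      intro s hs
      obtain ⟨hst, hs⟩ := Finset.mem_erase.1 hs
      refine (hS s hs).2.resolve_left fun h => hst (mul_right_cancel₀ hr0 ?_)
      linear_combination h - hpt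
    have hNcard : 7 ≤ (S.erase t).card := by rw [Finset.card_erase_of_mem htS]; omega
    obtain ⟨hpK, hrK⟩ := hfield _ (by omega) hN
    have htK : t ∈ E.K := by
      have : t = -p / conj p := by rw [eq_div_iff hr0]; linear_combination hpt
      rw [this]
      exact E.K.div_mem (E.K.neg_mem hpK) hrK
    rcases E.torsion hm t htK (hS t htS).1 with ht | ht
    · exact not_isChordProduct_of_diameter hm E hp0 hpr hpK hrK ht hpt hNcard hN
    · refine false_of_eight_chordEquation E hm.pos.ne' hp0 hpr hcard (P := E.φ p)
        (R := E.φ (conj p)) fun s hs => ?_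
      by_cases hst : s = t
      · subst hst
        refine .inr (.inr ⟨ht, ?_⟩)
        have h1 : E.φ p = s ^ 2 * E.φ (conj p) := by
          have h2 := E.map_mul (-s) (E.K.neg_mem htK) _ hrK
          rw [E.map_root _ ht, show -s * conj p = p by linear_combination -hpt] at h2
          rw [h2, neg_sq]
        rw [h1, hpt]; ring
      · exact (hN s (Finset.mem_erase.2 ⟨hst, hs⟩)).chordEquation hm E hpK hrK
  · push Not at hdiam
    have hN : ∀ s ∈ S, IsChordProduct p (2 * m) s := fun s hs =>
      (hS s hs).2.resolve_left (hdiam s hs)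
    obtain ⟨hpK, hrK⟩ := hfield S (by omega) hN
    exact false_of_eight_chordEquation E hm.pos.ne' hp0 hpr hcard
      fun s hs => (hN s hs).chordEquation hm E hpK hrK

open ComplexConjugate in
theorem false_of_eight {m : ℕ} (hm : Odd m) (b : ℕ) {p : ℂ} (hp0 : p ≠ 0) (hp : ‖p‖ < 1)
    {S : Finset ℂ} (hcard : 8 ≤ S.card)
    (hS : ∀ s ∈ S, IsOfFinOrder s ∧
      (p + s * conj p = 0 ∨ IsChordProduct p (2 * (2 ^ b * m)) s)) : False := by
  classical
  induction b generalizing p S with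
  | zero => exact false_of_eight_of_odd hm hp0 hp hcard (by simpa using hS)
  | succ b ih =>
    have hr0 : conj p ≠ 0 := by simpa using hp0
    have hk : 0 < 2 ^ b * m := Nat.mul_pos (by positivity) hm.pos
    have hM : 2 * (2 ^ (b + 1) * m) = 4 * (2 ^ b * m) := by ring
    rw [hM] at hS
    have hdiam : (S.filter fun s => p + s * conj p = 0).card ≤ 1 := by
      refine Finset.card_le_one.2 fun s hs t ht => mul_right_cancel₀ hr0 ?_
      linear_combination (Finset.mem_filter.1 hs).2 - (Finset.mem_filter.1 ht).2
    have hadd := Finset.card_filter_add_card_filter_not (s := S) (fun s => p + s * conj p = 0)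
    obtain ⟨ρ, hρ, h⟩ := exists_rotation_of_four_dvd hk hp
      (S := S.filter fun s => ¬ p + s * conj p = 0) (by omega) fun s hs =>
        (hS s (Finset.mem_filter.1 hs).1).2.resolve_left (Finset.mem_filter.1 hs).2
    have hρn := norm_eq_one_of_pow (by omega) hρ
    have hρ0 : ρ ≠ 0 := by rintro rfl; simp at hρn
    have hρρ : ρ * conj ρ = 1 := by
      rw [Complex.mul_conj, Complex.normSq_eq_norm_sq, hρn]; simp
    have hρfin : IsOfFinOrder (ρ ^ 2) :=
      (isOfFinOrder_iff_pow_eq_one.2 ⟨_, by omega, hρ⟩).pow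
    refine ih (p := ρ * p) (S := S.image (ρ ^ 2 * ·)) (mul_ne_zero hρ0 hp0)
      (by rwa [norm_mul, hρn, one_mul]) ?_ fun s hs => ?_
    · rwa [Finset.card_image_of_injective _ (mul_right_injective₀ (pow_ne_zero 2 hρ0))]
    · obtain ⟨s, hsS, rfl⟩ := Finset.mem_image.1 hs
      refine ⟨hρfin.mul (hS s hsS).1, ?_⟩
      by_cases hps : p + s * conj p = 0
      · refine .inl ?_
        rw [map_mul]
        linear_combination ρ * hps + ρ * s * conj p * hρρ
      · exact .inr (h s (Finset.mem_filter.2 ⟨hsS, hps⟩))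

theorem norm_lt_one_of_mem_interior_Ngon {n : ℕ} (hn : n ≠ 0) {p : ℂ}
    (hp : p ∈ interior (Ngon n)) : ‖p‖ < 1 := by
  have hsub : Ngon n ⊆ Metric.closedBall 0 1 :=
    convexHull_min (fun z hz => by simp [norm_eq_one_of_pow hn hz]) (convex_closedBall 0 1)
  have := interior_mono hsub hp
  rw [interior_closedBall (0 : ℂ) one_ne_zero] at this
  simpa using this

open ComplexConjugate in
theorem add_eq_of_mem_segment {v w p : ℂ} (hv : ‖v‖ = 1) (hw : ‖w‖ = 1)
    (hp : p ∈ segment ℝ v w) : v + w = p + v * w * conj p := by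
  obtain ⟨a, b, -, -, hab, rfl⟩ := hp
  have hv' : v * conj v = 1 := by rw [Complex.mul_conj, Complex.normSq_eq_norm_sq, hv]; simp
  have hw' : w * conj w = 1 := by rw [Complex.mul_conj, Complex.normSq_eq_norm_sq, hw]; simp
  have hab' : (a : ℂ) + b = 1 := by exact_mod_cast hab
  simp only [Complex.real_smul, map_add, map_mul, Complex.conj_ofReal]
  linear_combination -(v + w) * hab' - a * w * hv' - b * v * hw'

theorem segment_eq_of_add_eq_of_mul_eq {v w v' w' : ℂ} (hadd : v + w = v' + w')
    (hmul : v * w = v' * w') : segment ℝ v w = segment ℝ v' w' := by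
  have : (v - v') * (v - w') = 0 := by linear_combination v * hadd - hmul
  rcases mul_eq_zero.1 this with h | h
  · obtain rfl := sub_eq_zero.1 h
    rw [add_left_cancel hadd]
  · obtain rfl := sub_eq_zero.1 h
    rw [add_comm v' v] at hadd
    rw [add_left_cancel hadd, segment_symm]

theorem at_most_seven_diagonals_through_noncenter_point (n : ℕ) (hn : 3 ≤ n)
    (p : ℂ) (hp : p ∈ interior (Ngon n)) (hp0 : p ≠ 0) :
    ¬ (8 ≤ Set.ncard {d : Set ℂ | IsDiagonal n d ∧ p ∈ d}) := by
  intro h8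
  obtain ⟨b, m, hm, rfl⟩ := Nat.exists_eq_two_pow_mul_odd (n := n) (by omega)
  have hn0 : 2 ^ b * m ≠ 0 := by omega
  have hnorm := norm_lt_one_of_mem_interior_Ngon hn0 hp
  set D := {d : Set ℂ | IsDiagonal (2 ^ b * m) d ∧ p ∈ d}
  have hchord : ∀ d ∈ D, ∃ s v w : ℂ, v * w = s ∧ v + w = p + s * (starRingEnd ℂ) p ∧
      v ^ (2 ^ b * m) = 1 ∧ w ^ (2 ^ b * m) = 1 ∧ d = segment ℝ v w := by
    rintro d ⟨⟨v, w, hv, hw, -, -, -, rfl⟩, hpd⟩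
    exact ⟨v * w, v, w, rfl, add_eq_of_mem_segment (norm_eq_one_of_pow hn0 hv)
      (norm_eq_one_of_pow hn0 hw) hpd, hv, hw, rfl⟩
  choose! f hf using hchord
  have hfin : D.Finite := Set.finite_of_ncard_pos (by omega)
  have hinj : Set.InjOn f D := by
    intro d hd d' hd' hdd
    obtain ⟨v, w, hvw, hadd, -, -, hseg⟩ := hf d hd
    obtain ⟨v', w', hvw', hadd', -, -, hseg'⟩ := hf d' hd'
    rw [hseg, hseg']
    exact segment_eq_of_add_eq_of_mul_eq (by rw [hadd, hadd', hdd]) (by rw [hvw, hvw', hdd])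
  refine false_of_eight hm b hp0 hnorm (S := hfin.toFinset.image f) ?_ fun s hs => ?_
  · rw [Finset.card_image_of_injOn (by simpa using hinj), ← Set.ncard_eq_toFinset_card D hfin]
    exact h8
  · obtain ⟨d, hd, rfl⟩ := Finset.mem_image.1 hs
    obtain ⟨v, w, hvw, hadd, hv, hw, -⟩ := hf d (hfin.mem_toFinset.1 hd)
    refine ⟨isOfFinOrder_iff_pow_eq_one.2 ⟨2 ^ b * m, by omega, ?_⟩, ?_⟩
    · rw [← hvw, mul_pow, hv, hw, one_mul]
    · by_cases h0 : v + w = 0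
      · exact .inl (by rw [← hadd, h0])
      · exact .inr ⟨v, w, by rw [mul_comm, pow_mul, hv, one_pow],
          by rw [mul_comm, pow_mul, hw, one_pow], hvw, h0, hadd⟩
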